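/- Let M be a perfect matching of the generalized Petersen graph P(n,2). If M contains exactly one spoke, then n is odd. If M contains at least two spokes, then for any two cyclically consecutive spokes u_i v_i and u_j v_j of M, the number of indices strictly between i and j in cyclic order is even; moreover, either this number is ≡ 0 (mod 4) for every pair of cyclically consecutive spokes of M, or it is ≡ 2 (mod 4) for every such pair. -/

import Mathlib

open SimpleGraph

/-- Vertices of the generalized Petersen graph `P(n,2)`:
`Sum.inl i` is the outer vertex `u_i`, `Sum.inr i` is the inner vertex `v_i`. -/
abbrev PV (n : ℕ) := ZMod n ⊕ ZMod n

/-- The outer vertex `u_i`. -/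
def pu {n : ℕ} (i : ZMod n) : PV n := Sum.inl i

/-- The inner vertex `v_i`. -/
def pv {n : ℕ} (i : ZMod n) : PV n := Sum.inr i

/-- The generalized Petersen graph `P(n,2)`, with edges
`u_i u_{i+2}`, `u_i v_i` (spokes) and `v_i v_{i+1}`, indices mod `n`. -/
def petersen (n : ℕ) : SimpleGraph (PV n) :=
  SimpleGraph.fromRel (fun x y =>
    (∃ i : ZMod n, x = pu i ∧ y = pu (i + 2)) ∨
    (∃ i : ZMod n, x = pu i ∧ y = pv i) ∨
    (∃ i : ZMod n, x = pv i ∧ y = pv (i + 1)))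

/-- `S` is a forcing set of the perfect matching `M` of `G`:
`S ⊆ M` and `S` is contained in no other perfect matching of `G`. -/
def IsForcingSet {V : Type*} (G : SimpleGraph V) (M : G.Subgraph) (S : Set (Sym2 V)) : Prop :=
  S ⊆ M.edgeSet ∧
    ∀ M' : G.Subgraph, M'.IsPerfectMatching → S ⊆ M'.edgeSet → M' = M

/-- The forcing number `f(G,M)`: the minimum cardinality of a forcing set of `M`. -/
noncomputable def forcingNumber {V : Type*} (G : SimpleGraph V) (M : G.Subgraph) : ℕ :=
  sInf {k | ∃ S : Set (Sym2 V), IsForcingSet G M S ∧ S.ncard = k}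

/-- Block `A` starting at position `i` (length 4). -/
def blockA (n : ℕ) (i : ZMod n) : Set (Sym2 (PV n)) :=
  {s(pu i, pu (i + 2)), s(pu (i + 1), pu (i + 3)), s(pv i, pv (i + 1)), s(pv (i + 2), pv (i + 3))}

/-- Block `B` at position `i` (length 1): a single spoke. -/
def blockB (n : ℕ) (i : ZMod n) : Set (Sym2 (PV n)) :=
  {s(pu i, pv i)}

/-- Block `C` starting at position `i` (length 3). -/
def blockC (n : ℕ) (i : ZMod n) : Set (Sym2 (PV n)) :=
  {s(pu i, pu (i + 2)), s(pu (i + 1), pv (i + 1)), s(pv (i + 2), pv (i + 3))}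

/-- Block `D` starting at position `i` (length 4). -/
def blockD (n : ℕ) (i : ZMod n) : Set (Sym2 (PV n)) :=
  {s(pu i, pu (i + 2)), s(pu (i + 1), pu (i + 3)), s(pv (i + 1), pv (i + 2)), s(pv (i + 3), pv (i + 4))}

/-- Length of an `A`/`B` block: `true` codes `A` (length 4), `false` codes `B` (length 1). -/
def abLen (b : Bool) : ℕ := if b then 4 else 1

/-- Edge set of a concatenation of `A`/`B` blocks starting at position `i`. -/
def abEdges (n : ℕ) : ZMod n → List Bool → Set (Sym2 (PV n))
  | _, [] => ∅
  | i, true :: L => blockA n i ∪ abEdges n (i + 4) L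
  | i, false :: L => blockB n i ∪ abEdges n (i + 1) L

/-- A perfect matching (given as a subgraph of `P(n,2)`) has type 1 if its edge set is
a cyclic concatenation of `A` and `B` blocks whose lengths sum to `n`. -/
def IsType1 {n : ℕ} (M : (petersen n).Subgraph) : Prop :=
  ∃ (i : ZMod n) (L : List Bool), (L.map abLen).sum = n ∧ M.edgeSet = abEdges n i L

/-- Length of a `C`/`D` block: `true` codes `C` (length 3), `false` codes `D` (length 4). -/
def cdLen (b : Bool) : ℕ := if b then 3 else 4

/-- Edge set of a concatenation of `C`/`D` blocks starting at position `i`. -/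
def cdEdges (n : ℕ) : ZMod n → List Bool → Set (Sym2 (PV n))
  | _, [] => ∅
  | i, true :: L => blockC n i ∪ cdEdges n (i + 3) L
  | i, false :: L => blockD n i ∪ cdEdges n (i + 4) L

/-- A perfect matching (given as a subgraph of `P(n,2)`) has type 2 if its edge set is
a cyclic concatenation of `C` and `D` blocks whose lengths sum to `n`. -/
def IsType2 {n : ℕ} (M : (petersen n).Subgraph) : Prop :=
  ∃ (i : ZMod n) (L : List Bool), (L.map cdLen).sum = n ∧ M.edgeSet = cdEdges n i L

/-- The set of indices of spokes belonging to `M`. -/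
def spokeIdx {n : ℕ} (M : (petersen n).Subgraph) : Set (ZMod n) :=
  {i | s(pu i, pv i) ∈ M.edgeSet}

/-- `i` and `j` are cyclically consecutive elements of `Sp`: both belong to `Sp`,
they are distinct, and no element of `Sp` lies strictly between `i` and `j` in the
cyclic order (going forward from `i`). -/
def CyclConsec {n : ℕ} (Sp : Set (ZMod n)) (i j : ZMod n) : Prop :=
  i ∈ Sp ∧ j ∈ Sp ∧ i ≠ j ∧ ∀ k ∈ Sp, k ≠ i → (j - i).val ≤ (k - i).val

/-- Exactly one of three propositions holds. -/
def ExactlyOne (p q r : Prop) : Prop :=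
  (p ∨ q ∨ r) ∧ ¬(p ∧ q) ∧ ¬(p ∧ r) ∧ ¬(q ∧ r)

theorem petersen_adj_pu {n : ℕ} {i : ZMod n} {w : PV n} (h : (petersen n).Adj (pu i) w) :
    w = pu (i + 2) ∨ w = pu (i - 2) ∨ w = pv i := by
  rw [petersen, SimpleGraph.fromRel_adj] at h
  obtain ⟨-, (⟨k, h₁, h₂⟩ | ⟨k, h₁, h₂⟩ | ⟨k, h₁, h₂⟩) |
    (⟨k, h₁, h₂⟩ | ⟨k, h₁, h₂⟩ | ⟨k, h₁, h₂⟩)⟩ := h <;> simp_all [pu, pv]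

theorem petersen_adj_pv {n : ℕ} {i : ZMod n} {w : PV n} (h : (petersen n).Adj (pv i) w) :
    w = pv (i + 1) ∨ w = pv (i - 1) ∨ w = pu i := by
  rw [petersen, SimpleGraph.fromRel_adj] at h
  obtain ⟨-, (⟨k, h₁, h₂⟩ | ⟨k, h₁, h₂⟩ | ⟨k, h₁, h₂⟩) |
    (⟨k, h₁, h₂⟩ | ⟨k, h₁, h₂⟩ | ⟨k, h₁, h₂⟩)⟩ := h <;> simp_all [pu, pv]

theorem natCast_ne_zero_of_lt {n k : ℕ} (hk : 0 < k) (hkn : k < n) : (k : ZMod n) ≠ 0 := by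
  rw [Ne, ZMod.natCast_eq_zero_iff]
  exact Nat.not_dvd_of_pos_of_lt hk hkn

section Matching

variable {n : ℕ} {M : (petersen n).Subgraph}

theorem exactlyOne_inner (hn : 3 ≤ n) (hM : M.IsPerfectMatching) (i : ZMod n) :
    ExactlyOne (M.Adj (pv (i + 1)) (pv (i + 1 + 1))) (M.Adj (pv i) (pv (i + 1)))
      (M.Adj (pu (i + 1)) (pv (i + 1))) := by
  obtain ⟨w, hw, huniq⟩ := SimpleGraph.Subgraph.isPerfectMatching_iff.1 hM (pv (i + 1))
  have h2 : ((2 : ℕ) : ZMod n) ≠ 0 := natCast_ne_zero_of_lt (by omega) (by omega)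
  have hne : i + 1 + 1 ≠ i := fun h => h2 (by push_cast; linear_combination h)
  have hcases := petersen_adj_pv hw.adj_sub
  rw [add_sub_cancel_right] at hcases
  refine ⟨?_, ?_, ?_, ?_⟩
  · rcases hcases with rfl | rfl | rfl
    exacts [.inl hw, .inr (.inl hw.symm), .inr (.inr hw.symm)]
  · rintro ⟨h, h'⟩
    exact hne (Sum.inr.inj ((huniq _ h).trans (huniq _ h'.symm).symm))
  · rintro ⟨h, h'⟩
    exact Sum.inr_ne_inl ((huniq _ h).trans (huniq _ h'.symm).symm)
  · rintro ⟨h, h'⟩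
    exact Sum.inr_ne_inl ((huniq _ h.symm).trans (huniq _ h'.symm).symm)

theorem exactlyOne_outer (hn : 3 ≤ n) (hn4 : n ≠ 4) (hM : M.IsPerfectMatching) (i : ZMod n) :
    ExactlyOne (M.Adj (pu (i + 2)) (pu (i + 2 + 2))) (M.Adj (pu i) (pu (i + 2)))
      (M.Adj (pu (i + 2)) (pv (i + 2))) := by
  obtain ⟨w, hw, huniq⟩ := SimpleGraph.Subgraph.isPerfectMatching_iff.1 hM (pu (i + 2))
  have h4 : ((4 : ℕ) : ZMod n) ≠ 0 := by
    rw [Ne, ZMod.natCast_eq_zero_iff]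
    intro h
    have := Nat.le_of_dvd (by omega) h
    interval_cases n <;> omega
  have hne : i + 2 + 2 ≠ i := fun h => h4 (by push_cast; linear_combination h)
  have hcases := petersen_adj_pu hw.adj_sub
  rw [add_sub_cancel_right] at hcases
  refine ⟨?_, ?_, ?_, ?_⟩
  · rcases hcases with rfl | rfl | rfl
    exacts [.inl hw, .inr (.inl hw.symm), .inr (.inr hw)]
  · rintro ⟨h, h'⟩
    exact hne (Sum.inl.inj ((huniq _ h).trans (huniq _ h'.symm).symm))
  · rintro ⟨h, h'⟩
    exact Sum.inl_ne_inr ((huniq _ h).trans (huniq _ h').symm)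
  · rintro ⟨h, h'⟩
    exact Sum.inl_ne_inr ((huniq _ h.symm).trans (huniq _ h').symm)

end Matching

/-- In `P(4,2)` the spokes of a perfect matching are closed under rotation. -/
theorem spoke_succ_of_four {M : (petersen 4).Subgraph} (hM : M.IsPerfectMatching) {i : ZMod 4}
    (hi : M.Adj (pu i) (pv i)) : M.Adj (pu (i + 1)) (pv (i + 1)) := by
  have hmatch := SimpleGraph.Subgraph.isPerfectMatching_iff.1 hM
  have h4 : (4 : ZMod 4) = 0 := rfl
  have hopp : M.Adj (pu (i + 2)) (pv (i + 2)) := by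
    obtain ⟨w, hw, -⟩ := hmatch (pu (i + 2))
    have h₁ : i + 2 + 2 = i := by linear_combination h4
    have h₂ : ¬M.Adj (pu (i + 2)) (pu i) := fun h =>
      Sum.inl_ne_inr ((hmatch (pu i)).unique h.symm hi)
    rcases petersen_adj_pu hw.adj_sub with rfl | rfl | rfl
    · rw [h₁] at hw
      exact absurd hw h₂
    · rw [add_sub_cancel_right] at hw
      exact absurd hw h₂
    · exact hw
  have h₀ := exactlyOne_inner (by norm_num) hM i
  have h₁ := exactlyOne_inner (by norm_num) hM (i - 1)
  have h₂ := exactlyOne_inner (by norm_num) hM (i + 1)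
  rw [sub_add_cancel] at h₁
  rw [show i + 1 + 1 = i + 2 by ring] at h₀ h₂
  unfold ExactlyOne at h₀ h₁ h₂
  clear hmatch h4
  grind

section Recurrence

variable {a b s : ℕ → Prop}

theorem state_after_spoke (hu : ∀ k, ExactlyOne (a (k + 2)) (a k) (s (k + 2)))
    (hv : ∀ k, ExactlyOne (b (k + 1)) (b k) (s (k + 1))) (hs : s 2) (m : ℕ)
    (hm : ∀ k < m, ¬s (k + 3)) :
    (¬a 1 ∧ (m % 4 = 0 ∧ ¬a (m + 1) ∧ ¬a (m + 2) ∧ ¬b (m + 2) ∨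
        m % 4 = 1 ∧ ¬a (m + 1) ∧ a (m + 2) ∧ b (m + 2) ∨
        m % 4 = 2 ∧ a (m + 1) ∧ a (m + 2) ∧ ¬b (m + 2) ∨
        m % 4 = 3 ∧ a (m + 1) ∧ ¬a (m + 2) ∧ b (m + 2))) ∨
      (a 1 ∧ (m % 4 = 0 ∧ a (m + 1) ∧ ¬a (m + 2) ∧ ¬b (m + 2) ∨
        m % 4 = 1 ∧ ¬a (m + 1) ∧ ¬a (m + 2) ∧ b (m + 2) ∨
        m % 4 = 2 ∧ ¬a (m + 1) ∧ a (m + 2) ∧ ¬b (m + 2) ∨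
        m % 4 = 3 ∧ a (m + 1) ∧ a (m + 2) ∧ b (m + 2))) := by
  induction m with
  | zero =>
    have h₁ := hu 0
    have h₂ := hv 1
    simp only [ExactlyOne, Nat.zero_add, Nat.reduceAdd] at h₁ h₂ ⊢
    simp
    tauto
  | succ m ih =>
    have ih := ih fun k hk => hm k (by omega)
    have hsm := hm m (by omega)
    have h₁ := hu (m + 1)
    have h₂ := hv (m + 2)
    simp only [ExactlyOne, Nat.add_assoc, Nat.reduceAdd] at h₁ h₂ ⊢
    rw [Nat.add_mod m 1 4]
    clear hu hv hm
    rcases ih with ⟨h, ih | ih | ih | ih⟩ | ⟨h, ih | ih | ih | ih⟩ <;>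
      obtain ⟨hmod, h₃, h₄, h₅⟩ := ih <;> simp_all

theorem gap_mod_four (hu : ∀ k, ExactlyOne (a (k + 2)) (a k) (s (k + 2)))
    (hv : ∀ k, ExactlyOne (b (k + 1)) (b k) (s (k + 1))) (hs : s 2) (m : ℕ)
    (hm : ∀ k < m, ¬s (k + 3)) (hend : s (m + 3)) :
    m % 4 = 0 ∧ ¬a 1 ∨ m % 4 = 2 ∧ a 1 := by
  have h := state_after_spoke hu hv hs m hm
  have h₁ := hu (m + 1)
  have h₂ := hv (m + 2)
  simp only [ExactlyOne, Nat.add_assoc, Nat.reduceAdd] at h₁ h₂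
  clear hu hv hm
  rcases h with ⟨h, h' | h' | h' | h'⟩ | ⟨h, h' | h' | h' | h'⟩ <;> simp_all

end Recurrence

theorem ZMod.iff_of_forall_succ {n : ℕ} [NeZero n] {P : ZMod n → Prop}
    (h : ∀ i, P (i + 1) ↔ P i) (i j : ZMod n) : P i ↔ P j := by
  have key (k : ℕ) : P (j + k) ↔ P j := by
    induction k with
    | zero => simp
    | succ k ih => rw [Nat.cast_succ, ← add_assoc, h, ih]
  simpa using key (i - j).val

/-- For a perfect matching with `n ≠ 4`, the gap after a spoke is `0` or `2` modulo `4`,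
and which of the two occurs does not depend on the spoke. -/
theorem exists_gap_mod_four {n : ℕ} (hn : 3 ≤ n) (hn4 : n ≠ 4) {M : (petersen n).Subgraph}
    (hM : M.IsPerfectMatching) :
    ∃ T : Prop, ∀ (i : ZMod n) (m : ℕ), i ∈ spokeIdx M →
      (∀ k < m, i + (k + 1 : ℕ) ∉ spokeIdx M) → i + (m + 1 : ℕ) ∈ spokeIdx M →
      m % 4 = 0 ∧ ¬T ∨ m % 4 = 2 ∧ T := by
  have : NeZero n := ⟨by omega⟩
  set a : ZMod n → Prop := fun i => M.Adj (pu i) (pu (i + 2))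
  set b : ZMod n → Prop := fun i => M.Adj (pv i) (pv (i + 1))
  set s : ZMod n → Prop := fun i => M.Adj (pu i) (pv i)
  have hu : ∀ i, ExactlyOne (a (i + 2)) (a i) (s (i + 2)) := exactlyOne_outer hn hn4 hM
  have hv : ∀ i, ExactlyOne (b (i + 1)) (b i) (s (i + 1)) := exactlyOne_inner hn hM
  let P : ZMod n → Prop := fun i => Xor (Xor (a i) (a (i + 1))) (b (i + 1))
  have hP : ∀ i, P (i + 1) ↔ P i := by
    intro i
    have h₁ := hu i
    have h₂ := hv (i + 1)
    simp only [P, ExactlyOne, Xor, show i + 1 + 1 = i + 2 by ring] at h₁ h₂ ⊢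
    grind
  refine ⟨P 0, fun i m hi hm hend => ?_⟩
  have hs_iff (j : ZMod n) : j ∈ spokeIdx M ↔ s j := Iff.rfl
  rw [hs_iff] at hi hend
  rw [ZMod.iff_of_forall_succ hP 0 (i - 1)]
  have hshift (k l : ℕ) : i - 2 + (k + l : ℕ) = i - 2 + k + l := by push_cast; ring
  have key := gap_mod_four (a := fun k : ℕ => a (i - 2 + k)) (b := fun k : ℕ => b (i - 2 + k))
    (s := fun k : ℕ => s (i - 2 + k))
    (fun k => by simpa only [hshift, Nat.cast_ofNat] using hu (i - 2 + k))
    (fun k => by simpa only [hshift, Nat.cast_one] using hv (i - 2 + k))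
    (by simpa using hi) m
    (fun k hk h => hm k hk <| by
      rw [hs_iff]; convert h using 1; push_cast; ring)
    (by convert hend using 1; push_cast; ring)
  have h₁ := hu (i - 2)
  have h₂ := hv (i - 1)
  simp only [P, Xor, ExactlyOne, sub_add_cancel, Nat.cast_one,
    show i - 2 + 1 = i - 1 by ring] at h₁ h₂ key ⊢
  grind

theorem CyclConsec.gap_spec {n : ℕ} [NeZero n] {S : Set (ZMod n)} {i j : ZMod n}
    (h : CyclConsec S i j) :
    (∀ k < (j - i).val - 1, i + (k + 1 : ℕ) ∉ S) ∧ i + ((j - i).val - 1 + 1 : ℕ) ∈ S := by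
  obtain ⟨-, hj, hij, hmin⟩ := h
  have hpos : 0 < (j - i).val := ZMod.val_pos.2 (sub_ne_zero.2 hij.symm)
  have hlt := ZMod.val_lt (j - i)
  refine ⟨fun k hk hmem => ?_, ?_⟩
  · have hk0 : ((k + 1 : ℕ) : ZMod n) ≠ 0 := natCast_ne_zero_of_lt (by omega) (by omega)
    have hle := hmin _ hmem (by simpa only [ne_eq, add_eq_left] using hk0)
    rw [add_sub_cancel_left, ZMod.val_natCast_of_lt (by omega)] at hle
    omega
  · rw [Nat.sub_add_cancel hpos, ZMod.natCast_zmod_val, add_sub_cancel]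
    exact hj

/-- spoke structure of a perfect matching of `P(n,2)`.
The number of indices strictly between cyclically consecutive spokes `u_i v_i` and
`u_j v_j` is `(j - i).val - 1`. -/
theorem spoke_gaps (n : ℕ) (hn : 3 ≤ n) (M : (petersen n).Subgraph)
    (hM : M.IsPerfectMatching) :
    ((spokeIdx M).ncard = 1 → Odd n) ∧
    (2 ≤ (spokeIdx M).ncard →
      (∀ i j : ZMod n, CyclConsec (spokeIdx M) i j → Even ((j - i).val - 1)) ∧
      ((∀ i j : ZMod n, CyclConsec (spokeIdx M) i j → ((j - i).val - 1) % 4 = 0) ∨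
       (∀ i j : ZMod n, CyclConsec (spokeIdx M) i j → ((j - i).val - 1) % 4 = 2))) := by
  have : NeZero n := ⟨by omega⟩
  rcases eq_or_ne n 4 with rfl | hn4
  · have h10 : (1 : ZMod 4) ≠ 0 := by decide
    have hsucc : ∀ i ∈ spokeIdx M, i + 1 ∈ spokeIdx M := fun i hi => spoke_succ_of_four hM hi
    have hgap : ∀ i j, CyclConsec (spokeIdx M) i j → (j - i).val - 1 = 0 := by
      intro i j h
      have hle := h.2.2.2 _ (hsucc i h.1) (by simpa using h10)
      rw [add_sub_cancel_left, show (1 : ZMod 4).val = 1 from rfl] at hle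
      omega
    refine ⟨fun h => ?_, fun _ => ⟨fun i j h => ?_, .inl fun i j h => ?_⟩⟩
    · obtain ⟨i, hi⟩ := Set.ncard_eq_one.1 h
      have h' := hsucc i (by simp [hi])
      rw [hi, Set.mem_singleton_iff, add_eq_left] at h'
      exact absurd h' h10
    · rw [hgap i j h]
      exact Even.zero
    · rw [hgap i j h]
  · obtain ⟨T, hT⟩ := exists_gap_mod_four hn hn4 hM
    have hgap : ∀ i j, CyclConsec (spokeIdx M) i j →
        ((j - i).val - 1) % 4 = 0 ∧ ¬T ∨ ((j - i).val - 1) % 4 = 2 ∧ T :=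
      fun i j h => hT i _ h.1 h.gap_spec.1 h.gap_spec.2
    refine ⟨fun h => ?_, fun _ => ⟨fun i j h => ?_, ?_⟩⟩
    · obtain ⟨i, hi⟩ := Set.ncard_eq_one.1 h
      have key := hT i (n - 1) (by simp [hi])
        (fun k hk => by
          rw [hi, Set.mem_singleton_iff, add_eq_left]
          exact natCast_ne_zero_of_lt (by omega) (by omega))
        (by rw [Nat.sub_add_cancel (by omega)]; simp [hi])
      rw [Nat.odd_iff]
      omega
    · have := hgap i j h
      rw [Nat.even_iff]
      omega
    · by_cases hTrue : T
      · exact .inr fun i j h => by have := hgap i j h; tauto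
      · exact .inl fun i j h => by have := hgap i j h; tauto
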